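/- Suppose the smooth function p : ℝ² → ℝ admits a non-degenerate well along the closed curve γ = c(ℝ) with minimal value b₀. Then there exist δ > 0, a smooth function g : (−δ, δ) → ℝ with g(0) = 0 and g'(I) ≠ 0 for all I ∈ (−δ, δ), and a smooth map Φ : ℝ × (−δ, δ) → ℝ² ('folded action-angle coordinates') such that: Φ(θ + 2π, I) = Φ(θ, I) for all (θ, I); Φ is injective on [0, 2π) × (−δ, δ); the Jacobian determinant of Φ equals 1 at every point (Φ is symplectic for the standard area form on ℝ²); the image of Φ is an open neighborhood of γ; Φ(θ, 0) ∈ γ for all θ; and p(Φ(θ, I)) = b₀ + g(I)² for all (θ, I). -/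

import Mathlib

open Real Set

/-- A smooth function `p : ℝ² → ℝ` admits a non-degenerate well along the closed curve
`γ = c(ℝ)` with minimal value `b₀`: `c` is a smooth `2π`-periodic regular injective loop,
`p` is minimal on `γ` in a neighborhood `Ω`, and the Hessian of `p` is non-degenerate in the
direction transversal to the curve. -/
def NondegenerateWell (p : ℝ × ℝ → ℝ) (c : ℝ → ℝ × ℝ) (b₀ : ℝ) : Prop :=
  ContDiff ℝ (⊤ : ℕ∞) p ∧ ContDiff ℝ (⊤ : ℕ∞) c ∧
  (∀ t, c (t + 2 * π) = c t) ∧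
  (∀ t, deriv c t ≠ 0) ∧
  Set.InjOn c (Set.Ico 0 (2 * π)) ∧
  (∃ Ω : Set (ℝ × ℝ), IsOpen Ω ∧ Set.range c ⊆ Ω ∧
    (∀ m ∈ Set.range c, p m = b₀) ∧ (∀ m ∈ Ω \ Set.range c, b₀ < p m)) ∧
  (∀ t, ∀ ν : ℝ × ℝ, ν ≠ 0 → ν.1 * (deriv c t).1 + ν.2 * (deriv c t).2 = 0 →
    iteratedFDeriv ℝ 2 p (c t) ![ν, ν] ≠ 0)

open Filter Topology

theorem hasFDerivAt_intervalIntegral_of_contDiff {E F : Type} [NormedAddCommGroup E]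
    [NormedSpace ℝ E] [ProperSpace E] [NormedAddCommGroup F] [NormedSpace ℝ F] [CompleteSpace F]
    {f : E × ℝ → F} (hf : ContDiff ℝ 1 f) (x : E) :
    HasFDerivAt (fun x => ∫ u in (0:ℝ)..1, f (x, u))
      (∫ u in (0:ℝ)..1, (fderiv ℝ f (x, u)).comp (ContinuousLinearMap.inl ℝ E ℝ)) x := by
  have hf' : Continuous fun z : E × ℝ => (fderiv ℝ f z).comp (ContinuousLinearMap.inl ℝ E ℝ) :=
    (hf.continuous_fderiv one_ne_zero).clm_comp continuous_const
  obtain ⟨C, hC⟩ := ((isCompact_closedBall x 1).prod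
    (isCompact_Icc (a := (0:ℝ)) (b := 1))).exists_bound_of_continuousOn hf'.continuousOn
  refine intervalIntegral.hasFDerivAt_integral_of_dominated_of_fderiv_le (bound := fun _ => C)
    (F := fun x u => f (x, u))
    (F' := fun x u => (fderiv ℝ f (x, u)).comp (ContinuousLinearMap.inl ℝ E ℝ))
    (Metric.closedBall_mem_nhds x one_pos) ?_ ?_ ?_ ?_ ?_ ?_
  · refine Eventually.of_forall fun y => Continuous.aestronglyMeasurable ?_
    exact hf.continuous.comp (by fun_prop)
  · refine Continuous.intervalIntegrable ?_ _ _
    exact hf.continuous.comp (by fun_prop)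
  · have : SecondCountableTopologyEither ℝ (E →L[ℝ] F) := ⟨Or.inl inferInstance⟩
    refine Continuous.aestronglyMeasurable ?_
    exact hf'.comp (by fun_prop : Continuous fun u : ℝ => (x, u))
  · refine Eventually.of_forall fun u hu y hy => hC (y, u) ⟨hy, ?_⟩
    rw [uIoc_of_le zero_le_one] at hu
    exact ⟨hu.1.le, hu.2⟩
  · simp
  · refine Eventually.of_forall fun u _ y _ => ?_
    have h1 : HasFDerivAt f (fderiv ℝ f (y, u)) (y, u) :=
      (hf.differentiable one_ne_zero (y, u)).hasFDerivAt
    exact h1.comp y (hasFDerivAt_prodMk_left y u)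

theorem contDiff_nat_intervalIntegral {E : Type} [NormedAddCommGroup E]
    [NormedSpace ℝ E] [ProperSpace E] (n : ℕ) :
    ∀ {F : Type} [NormedAddCommGroup F] [NormedSpace ℝ F] [CompleteSpace F]
    {f : E × ℝ → F}, ContDiff ℝ n f → ContDiff ℝ n fun x => ∫ u in (0:ℝ)..1, f (x, u) := by
  induction n with
  | zero =>
    intro F _ _ _ f hf
    rw [Nat.cast_zero, contDiff_zero] at hf ⊢
    exact intervalIntegral.continuous_parametric_intervalIntegral_of_continuous' (by exact hf) 0 1
  | succ n ih =>
    intro F _ _ _ f hf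
    refine contDiff_succ_iff_hasFDerivAt.2 ⟨_, ?_, fun x =>
      hasFDerivAt_intervalIntegral_of_contDiff (hf.of_le ?_) x⟩
    · refine ih (f := fun z => (fderiv ℝ f z).comp (ContinuousLinearMap.inl ℝ E ℝ)) ?_
      exact (hf.fderiv_right (by norm_cast)).clm_comp contDiff_const
    · exact_mod_cast Nat.le_add_left 1 n

theorem contDiff_infty_intervalIntegral {E F : Type} [NormedAddCommGroup E]
    [NormedSpace ℝ E] [ProperSpace E] [NormedAddCommGroup F] [NormedSpace ℝ F] [CompleteSpace F]
    {f : E × ℝ → F} (hf : ContDiff ℝ (⊤ : ℕ∞) f) :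
    ContDiff ℝ (⊤ : ℕ∞) fun x => ∫ u in (0:ℝ)..1, f (x, u) :=
  contDiff_infty.2 fun n => contDiff_nat_intervalIntegral n (contDiff_infty.1 hf n)

theorem det_eq_of_prod (L : ℝ × ℝ →L[ℝ] ℝ × ℝ) :
    L.det = (L (1, 0)).1 * (L (0, 1)).2 - (L (0, 1)).1 * (L (1, 0)).2 := by
  rw [ContinuousLinearMap.det, ← LinearMap.det_toMatrix (Module.Basis.finTwoProd ℝ),
    Matrix.det_fin_two]
  simp [LinearMap.toMatrix_apply]

theorem det_clm_comp (A B : ℝ × ℝ →L[ℝ] ℝ × ℝ) : (A.comp B).det = A.det * B.det :=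
  LinearMap.det_comp _ _

/-- A property holding near every point of `ℝ × {0}` and invariant under the shift
`t ↦ t + 2π` holds on a strip. -/
theorem exists_strip {Q : ℝ × ℝ → Prop} (hQ : ∀ t, ∀ᶠ z in 𝓝 (t, (0:ℝ)), Q z)
    (hper : ∀ t s, Q (t, s) → ∀ k : ℤ, Q (t + k * (2 * π), s)) :
    ∃ ε > 0, ∀ t s, |s| < ε → Q (t, s) := by
  have h := (isCompact_Icc (a := (0:ℝ)) (b := 2 * π)).eventually_forall_of_forall_eventually
    (x₀ := (0:ℝ)) (P := fun s t => Q (t, s)) (fun t _ => by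
      have := (continuous_swap.tendsto ((0:ℝ), t)).eventually (hQ t)
      exact this)
  obtain ⟨ε, hε, H⟩ := Metric.eventually_nhds_iff.1 h
  refine ⟨ε, hε, fun t s hs => ?_⟩
  have h1 := H (y := s) (by simpa using hs) (toIcoMod two_pi_pos 0 t)
    (by have := toIcoMod_mem_Ico two_pi_pos 0 t; exact ⟨this.1, by linarith [this.2]⟩)
  have h2 := hper _ _ h1 (toIcoDiv two_pi_pos 0 t)
  rwa [← zsmul_eq_mul, toIcoMod_add_toIcoDiv_zsmul] at h2

/-- An orientation preserving change of coordinates of the strip `ℝ × (-ε, ε)` which commutes with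
the shift by `2π` in the first variable and preserves the line `ℝ × {0}`. -/
structure IsShear (ε : ℝ) (f : ℝ × ℝ → ℝ × ℝ) : Prop where
  pos : 0 < ε
  contDiffAt : ∀ z : ℝ × ℝ, |z.2| < ε → ContDiffAt ℝ (⊤ : ℕ∞) f z
  det_pos : ∀ z : ℝ × ℝ, |z.2| < ε → 0 < (fderiv ℝ f z).det
  shift : ∀ t s, |s| < ε → f (t + 2 * π, s) = ((f (t, s)).1 + 2 * π, (f (t, s)).2)
  inj : ∀ z w : ℝ × ℝ, |z.2| < ε → |w.2| < ε → f z = f w → z = w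
  snd_core : ∀ t, (f (t, 0)).2 = 0
  core_surj : ∀ θ, ∃ t, f (t, 0) = (θ, 0)

/-- `e` is a smooth right inverse of the shear `f` on the strip `ℝ × (-δ, δ)`. -/
structure IsShearInverse (ε : ℝ) (f : ℝ × ℝ → ℝ × ℝ) (δ : ℝ) (e : ℝ × ℝ → ℝ × ℝ) : Prop where
  pos : 0 < δ
  mem : ∀ z : ℝ × ℝ, |z.2| < δ → |(e z).2| < ε
  right_inv : ∀ z : ℝ × ℝ, |z.2| < δ → f (e z) = z
  contDiffAt : ∀ z : ℝ × ℝ, |z.2| < δ → ContDiffAt ℝ (⊤ : ℕ∞) e z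

theorem isOpen_strip (ε : ℝ) : IsOpen {z : ℝ × ℝ | |z.2| < ε} :=
  isOpen_lt (by fun_prop) continuous_const

theorem contDiffAt_invFunOn {f : ℝ × ℝ → ℝ × ℝ} {U : Set (ℝ × ℝ)} (hU : IsOpen U)
    (hinj : InjOn f U) {z : ℝ × ℝ} (hz : z ∈ U) (hf : ContDiffAt ℝ (⊤ : ℕ∞) f z)
    (hdet : (fderiv ℝ f z).det ≠ 0) :
    f '' U ∈ 𝓝 (f z) ∧ ContDiffAt ℝ (⊤ : ℕ∞) (Function.invFunOn f U) (f z) := by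
  have hn : ((⊤ : ℕ∞) : WithTop ℕ∞) ≠ 0 := by simp
  have hd : HasFDerivAt f
      ((ContinuousLinearMap.toContinuousLinearEquivOfDetNeZero _ hdet :
        (ℝ × ℝ) ≃L[ℝ] (ℝ × ℝ)) : ℝ × ℝ →L[ℝ] ℝ × ℝ) z := by
    rw [ContinuousLinearMap.coe_toContinuousLinearEquivOfDetNeZero]
    exact (hf.differentiableAt hn).hasFDerivAt
  have hl := hf.to_localInverse hd hn
  have hlz := hf.localInverse_apply_image hd hn
  have hright := (hf.hasStrictFDerivAt' hd hn).eventually_right_inverse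
  have hmem : ∀ᶠ y in 𝓝 (f z), hf.localInverse hd hn y ∈ U :=
    hl.continuousAt.eventually_mem (by rw [hlz]; exact hU.mem_nhds hz)
  constructor
  · filter_upwards [hright, hmem] with y h1 h2 using ⟨_, h2, h1⟩
  · refine hl.congr_of_eventuallyEq ?_
    filter_upwards [hright, hmem] with y h1 h2
    have h3 : y ∈ f '' U := ⟨_, h2, h1⟩
    exact hinj (Function.invFunOn_mem h3) h2 ((Function.invFunOn_eq h3).trans h1.symm)

namespace IsShear

variable {ε : ℝ} {f : ℝ × ℝ → ℝ × ℝ}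

theorem shift_int (hf : IsShear ε f) {s : ℝ} (hs : |s| < ε) (k : ℤ) (t : ℝ) :
    f (t + k * (2 * π), s) = ((f (t, s)).1 + k * (2 * π), (f (t, s)).2) := by
  induction k using Int.induction_on generalizing t with
  | zero => simp
  | succ i ih =>
    have h := hf.shift (t + i * (2 * π)) s hs
    push_cast at ih ⊢
    rw [ih] at h
    rw [show t + ((i:ℝ) + 1) * (2 * π) = t + i * (2 * π) + 2 * π by ring, h]
    ext <;> simp; ring
  | pred i ih =>
    have h := hf.shift (t + (-i - 1) * (2 * π)) s hs
    push_cast at ih ⊢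
    rw [show t + (-(i:ℝ) - 1) * (2 * π) + 2 * π = t + -i * (2 * π) by ring, ih] at h
    have h1 := congrArg Prod.fst h
    have h2 := congrArg Prod.snd h
    simp only at h1 h2
    ext
    · simp only; linarith
    · simp only; rw [← h2]

theorem exists_inverse (hf : IsShear ε f) : ∃ δ e, IsShearInverse ε f δ e := by
  set U : Set (ℝ × ℝ) := {z | |z.2| < ε}
  have hU : IsOpen U := isOpen_strip ε
  have hinj : InjOn f U := fun z hz w hw h => hf.inj z w hz hw h
  have key := fun z (hz : z ∈ U) =>
    contDiffAt_invFunOn hU hinj hz (hf.contDiffAt z hz) (hf.det_pos z hz).ne'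
  obtain ⟨δ, hδ, H⟩ := exists_strip (Q := fun z => z ∈ f '' U) (fun θ => by
      obtain ⟨t, ht⟩ := hf.core_surj θ
      have := (key (t, 0) (by simpa [U] using hf.pos)).1
      rwa [ht] at this) (by
      rintro t s ⟨⟨a, b⟩, hw, hfw⟩ k
      refine ⟨(a + k * (2 * π), b), hw, ?_⟩
      rw [hf.shift_int hw, hfw])
  refine ⟨δ, Function.invFunOn f U, hδ, fun z hz => ?_, fun z hz => ?_, fun z hz => ?_⟩
  · exact Function.invFunOn_mem (H z.1 z.2 hz)
  · exact Function.invFunOn_eq (H z.1 z.2 hz)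
  · obtain ⟨w, hw, rfl⟩ : z ∈ f '' U := H z.1 z.2 hz
    exact (key w hw).2

end IsShear

/-- A smooth orientation preserving parametrization of a neighborhood of the closed curve `γ` by
the annulus `(ℝ / 2πℤ) × (-ε, ε)`, sending the core circle onto `γ`. -/
structure IsCollar (γ : Set (ℝ × ℝ)) (ε : ℝ) (F : ℝ × ℝ → ℝ × ℝ) : Prop where
  pos : 0 < ε
  contDiffAt : ∀ z : ℝ × ℝ, |z.2| < ε → ContDiffAt ℝ (⊤ : ℕ∞) F z
  det_pos : ∀ z : ℝ × ℝ, |z.2| < ε → 0 < (fderiv ℝ F z).det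
  periodic : ∀ t s, |s| < ε → F (t + 2 * π, s) = F (t, s)
  inj : ∀ z w : ℝ × ℝ, |z.2| < ε → |w.2| < ε → F z = F w →
    ∃ k : ℤ, z = (w.1 + k * (2 * π), w.2)
  core_mem : ∀ t, F (t, 0) ∈ γ
  core_surj : ∀ m ∈ γ, ∃ t, F (t, 0) = m

theorem IsCollar.mono {γ : Set (ℝ × ℝ)} {ε ε' : ℝ} {F : ℝ × ℝ → ℝ × ℝ} (hF : IsCollar γ ε F)
    (h0 : 0 < ε') (h : ε' ≤ ε) : IsCollar γ ε' F where
  pos := h0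
  contDiffAt z hz := hF.contDiffAt z (hz.trans_le h)
  det_pos z hz := hF.det_pos z (hz.trans_le h)
  periodic t s hs := hF.periodic t s (hs.trans_le h)
  inj z w hz hw := hF.inj z w (hz.trans_le h) (hw.trans_le h)
  core_mem := hF.core_mem
  core_surj := hF.core_surj

namespace IsShearInverse

variable {γ : Set (ℝ × ℝ)} {ε δ : ℝ} {f e F : ℝ × ℝ → ℝ × ℝ}

theorem shift (he : IsShearInverse ε f δ e) (hf : IsShear ε f) {t s : ℝ} (hs : |s| < δ) :
    e (t + 2 * π, s) = ((e (t, s)).1 + 2 * π, (e (t, s)).2) := by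
  have h0 := he.mem (t, s) hs
  refine hf.inj _ _ (he.mem _ hs) h0 ?_
  rw [he.right_inv (t + 2 * π, s) hs, hf.shift _ _ h0, Prod.mk.eta, he.right_inv (t, s) hs]

theorem left_inv_core (he : IsShearInverse ε f δ e) (hf : IsShear ε f) (t : ℝ) :
    e (f (t, 0)) = (t, 0) := by
  have h : |(f (t, 0)).2| < δ := by rw [hf.snd_core, abs_zero]; exact he.pos
  exact hf.inj _ _ (he.mem _ h) (by simpa using hf.pos) (he.right_inv _ h)

theorem snd_core (he : IsShearInverse ε f δ e) (hf : IsShear ε f) (θ : ℝ) :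
    (e (θ, 0)).2 = 0 := by
  obtain ⟨t, ht⟩ := hf.core_surj θ
  rw [← ht, he.left_inv_core hf]

theorem det_mul_det (he : IsShearInverse ε f δ e) (hf : IsShear ε f) {z : ℝ × ℝ}
    (hz : |z.2| < δ) : (fderiv ℝ f (e z)).det * (fderiv ℝ e z).det = 1 := by
  have h1 : HasFDerivAt f _ (e z) :=
    ((hf.contDiffAt _ (he.mem z hz)).differentiableAt (by simp)).hasFDerivAt
  have h2 : HasFDerivAt e _ z := ((he.contDiffAt z hz).differentiableAt (by simp)).hasFDerivAt
  have h3 := (h1.comp z h2).congr_of_eventuallyEq (f₁ := id) (by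
    filter_upwards [(isOpen_strip δ).mem_nhds hz] with w hw using (he.right_inv w hw).symm)
  have h4 := h3.unique (hasFDerivAt_id z)
  rw [← det_clm_comp, h4]
  exact LinearMap.det_id

theorem det_comp (he : IsShearInverse ε f δ e) (hF : IsCollar γ ε F) {z : ℝ × ℝ}
    (hz : |z.2| < δ) :
    (fderiv ℝ (F ∘ e) z).det = (fderiv ℝ F (e z)).det * (fderiv ℝ e z).det := by
  rw [fderiv_comp z ((hF.contDiffAt _ (he.mem z hz)).differentiableAt (by simp))
    ((he.contDiffAt z hz).differentiableAt (by simp)), det_clm_comp]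

theorem collar_comp (he : IsShearInverse ε f δ e) (hf : IsShear ε f) (hF : IsCollar γ ε F) :
    IsCollar γ δ (F ∘ e) where
  pos := he.pos
  contDiffAt z hz := (hF.contDiffAt _ (he.mem z hz)).comp z (he.contDiffAt z hz)
  det_pos z hz := by
    rw [he.det_comp hF hz]
    have h1 := he.det_mul_det hf hz
    have h2 := hf.det_pos _ (he.mem z hz)
    have h3 : 0 < (fderiv ℝ e z).det := by
      by_contra! h
      nlinarith
    exact mul_pos (hF.det_pos _ (he.mem z hz)) h3
  periodic t s hs := by
    rw [Function.comp, he.shift hf hs, hF.periodic _ _ (he.mem (t, s) hs)]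
    rfl
  inj z w hz hw h := by
    obtain ⟨k, hk⟩ := hF.inj _ _ (he.mem z hz) (he.mem w hw) h
    refine ⟨k, ?_⟩
    have h1 := hf.shift_int (he.mem w hw) k (e w).1
    rwa [← hk, he.right_inv z hz, Prod.mk.eta, he.right_inv w hw] at h1
  core_mem θ := by
    have h : e (θ, 0) = ((e (θ, 0)).1, 0) := Prod.ext rfl (he.snd_core hf θ)
    rw [Function.comp, h]
    exact hF.core_mem _
  core_surj m hm := by
    obtain ⟨t, rfl⟩ := hF.core_surj m hm
    refine ⟨(f (t, 0)).1, ?_⟩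
    have h : ((f (t, 0)).1, 0) = f (t, 0) := Prod.ext rfl (hf.snd_core t).symm
    rw [Function.comp, h, he.left_inv_core hf]

end IsShearInverse

theorem hasDerivAt_snd_slice {F : Type} [NormedAddCommGroup F] [NormedSpace ℝ F]
    {q : ℝ × ℝ → F} {z : ℝ × ℝ} (hq : DifferentiableAt ℝ q z) :
    HasDerivAt (fun s => q (z.1, s)) (fderiv ℝ q z (0, 1)) z.2 := by
  have h : HasDerivAt (fun s : ℝ => (z.1, s)) ((0 : ℝ), (1 : ℝ)) z.2 :=
    (hasDerivAt_const _ _).prodMk (hasDerivAt_id _)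
  exact HasFDerivAt.comp_hasDerivAt z.2 hq.hasFDerivAt h

theorem hasDerivAt_fst_slice {F : Type} [NormedAddCommGroup F] [NormedSpace ℝ F]
    {q : ℝ × ℝ → F} {z : ℝ × ℝ} (hq : DifferentiableAt ℝ q z) :
    HasDerivAt (fun t => q (t, z.2)) (fderiv ℝ q z (1, 0)) z.1 := by
  have h : HasDerivAt (fun t : ℝ => (t, z.2)) ((1 : ℝ), (0 : ℝ)) z.1 :=
    (hasDerivAt_id _).prodMk (hasDerivAt_const _ _)
  exact HasFDerivAt.comp_hasDerivAt z.1 hq.hasFDerivAt h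

/-- The smooth function `(q (t, s) - q (t, 0)) / s`. -/
noncomputable def hadamardQuotient (q : ℝ × ℝ → ℝ) (z : ℝ × ℝ) : ℝ :=
  ∫ u in (0:ℝ)..1, fderiv ℝ q (z.1, u * z.2) (0, 1)

theorem contDiff_hadamardQuotient {q : ℝ × ℝ → ℝ} (hq : ContDiff ℝ (⊤ : ℕ∞) q) :
    ContDiff ℝ (⊤ : ℕ∞) (hadamardQuotient q) := by
  refine contDiff_infty_intervalIntegral
    (f := fun z : (ℝ × ℝ) × ℝ => fderiv ℝ q (z.1.1, z.2 * z.1.2) (0, 1)) ?_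
  have h : ContDiff ℝ (⊤ : ℕ∞) (fderiv ℝ q) := hq.fderiv_right (by simp)
  exact (h.comp (by fun_prop)).clm_apply contDiff_const

theorem eq_add_mul_hadamardQuotient {q : ℝ × ℝ → ℝ} (hq : ContDiff ℝ (⊤ : ℕ∞) q) (t s : ℝ) :
    q (t, s) = q (t, 0) + s * hadamardQuotient q (t, s) := by
  have hc : Continuous fun u : ℝ => fderiv ℝ q (t, u) (0, 1) :=
    ((hq.continuous_fderiv (by simp)).comp (by fun_prop)).clm_apply continuous_const
  have h := intervalIntegral.integral_eq_sub_of_hasDerivAt (a := 0) (b := s)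
    (f := fun s => q (t, s)) (f' := fun u => fderiv ℝ q (t, u) (0, 1))
    (fun u _ => hasDerivAt_snd_slice (z := (t, u)) (hq.differentiable (by simp) _))
    (hc.intervalIntegrable _ _)
  have h2 := intervalIntegral.mul_integral_comp_mul_right
    (f := fun u => fderiv ℝ q (t, u) (0, 1)) (a := 0) (b := 1) s
  simp only [zero_mul, one_mul] at h2
  rw [hadamardQuotient, h2, h]
  ring

theorem fderiv_add_eq_of_periodic {F : Type} [NormedAddCommGroup F] [NormedSpace ℝ F]
    {q : ℝ × ℝ → F} {T : ℝ} (h : ∀ t s, q (t + T, s) = q (t, s)) (t s : ℝ) :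
    fderiv ℝ q (t + T, s) = fderiv ℝ q (t, s) := by
  have h1 : (fun z => q (z + (T, 0))) = q := by
    ext z
    rw [show z + (T, 0) = (z.1 + T, z.2) from Prod.ext rfl (add_zero _)]
    exact h z.1 z.2
  have h2 := fderiv_comp_add_right (𝕜 := ℝ) (f := q) (x := (t, s)) (T, 0)
  rw [h1] at h2
  simpa using h2.symm

theorem hadamardQuotient_periodic {q : ℝ × ℝ → ℝ} {T : ℝ} (h : ∀ t s, q (t + T, s) = q (t, s))
    (t s : ℝ) : hadamardQuotient q (t + T, s) = hadamardQuotient q (t, s) := by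
  simp only [hadamardQuotient, fderiv_add_eq_of_periodic h]

theorem hadamardQuotient_zero (q : ℝ × ℝ → ℝ) (t : ℝ) :
    hadamardQuotient q (t, 0) = fderiv ℝ q (t, 0) (0, 1) := by
  simp [hadamardQuotient]

theorem periodic_int {α : Type} {q : ℝ × ℝ → α} (h : ∀ t s, q (t + 2 * π, s) = q (t, s))
    (k : ℤ) (t s : ℝ) : q (t + k * (2 * π), s) = q (t, s) :=
  Function.Periodic.int_mul (f := fun t => q (t, s)) (fun t => h t s) k t

theorem IsShear.mono {ε ε' : ℝ} {f : ℝ × ℝ → ℝ × ℝ} (hf : IsShear ε f)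
    (h0 : 0 < ε') (h : ε' ≤ ε) : IsShear ε' f where
  pos := h0
  contDiffAt z hz := hf.contDiffAt z (hz.trans_le h)
  det_pos z hz := hf.det_pos z (hz.trans_le h)
  shift t s hs := hf.shift t s (hs.trans_le h)
  inj z w hz hw := hf.inj z w (hz.trans_le h) (hw.trans_le h)
  snd_core := hf.snd_core
  core_surj := hf.core_surj

theorem exists_isShear_mul_sqrt {h : ℝ × ℝ → ℝ} (hh : ContDiff ℝ (⊤ : ℕ∞) h)
    (hper : ∀ t s, h (t + 2 * π, s) = h (t, s)) (h0 : ∀ t, 0 < h (t, 0)) :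
    ∃ ε, IsShear ε (fun z => (z.1, z.2 * √(h z))) ∧ ∀ z : ℝ × ℝ, |z.2| < ε → 0 < h z := by
  set r : ℝ × ℝ → ℝ := fun z => z.2 * √(h z) with hr
  have hrd : ∀ z, 0 < h z → ContDiffAt ℝ (⊤ : ℕ∞) r z := fun z hz =>
    contDiffAt_snd.mul (hh.contDiffAt.sqrt hz.ne')
  have hrper : ∀ t s, r (t + 2 * π, s) = r (t, s) := fun t s => by simp [hr, hper]
  obtain ⟨ε, hε, H⟩ := exists_strip (Q := fun z => 0 < h z ∧ 0 < fderiv ℝ r z (0, 1)) (by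
      intro t
      refine (hh.continuous.continuousAt.eventually_const_lt (h0 t)).and ?_
      have hc : ContinuousAt (fun z => fderiv ℝ r z (0, 1)) (t, 0) := by
        have : ContDiffAt ℝ 0 (fderiv ℝ r) (t, 0) := (hrd _ (h0 t)).fderiv_right (by simp)
        exact this.continuousAt.clm_apply continuousAt_const
      refine hc.eventually_const_lt ?_
      have h1 := hasDerivAt_snd_slice (z := (t, 0)) ((hrd _ (h0 t)).differentiableAt (by simp))
      have h2 : DifferentiableAt ℝ (fun s => √(h (t, s))) 0 := by
        have : DifferentiableAt ℝ (fun s => h (t, s)) 0 :=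
          (hasDerivAt_snd_slice (z := (t, 0)) (hh.differentiable (by simp) _)).differentiableAt
        exact this.sqrt (h0 t).ne'
      have h3 := (hasDerivAt_id (0:ℝ)).mul h2.hasDerivAt
      beta_reduce
      rw [h1.unique h3]
      simpa using h0 t) (by
    intro t s hts k
    refine ⟨by rw [periodic_int hper]; exact hts.1, ?_⟩
    rw [fderiv_add_eq_of_periodic (periodic_int hrper k)]
    exact hts.2)
  have hd : ∀ z : ℝ × ℝ, |z.2| < ε → DifferentiableAt ℝ r z := fun z hz =>
    (hrd z (H z.1 z.2 hz).1).differentiableAt (by simp)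
  refine ⟨ε, ⟨hε, fun z hz => ?_, fun z hz => ?_, fun t s _ => ?_, ?_, fun t => ?_, fun θ => ?_⟩,
    fun z hz => (H z.1 z.2 hz).1⟩
  · exact contDiffAt_fst.prodMk (hrd z (H z.1 z.2 hz).1)
  · have h1 : HasFDerivAt (fun z => (z.1, r z)) _ z := hasFDerivAt_fst.prodMk (hd z hz).hasFDerivAt
    rw [h1.fderiv, det_eq_of_prod]
    simpa using (H z.1 z.2 hz).2
  · exact Prod.ext rfl (hrper t s)
  · rintro ⟨t, s⟩ ⟨t', s'⟩ hs hs' heq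
    obtain ⟨rfl, h2⟩ := Prod.mk.inj heq
    have hmono : StrictMonoOn (fun s => r (t, s)) (Ioo (-ε) ε) := by
      refine strictMonoOn_of_deriv_pos (convex_Ioo _ _) (fun s hs => ?_) fun s hs => ?_
      · exact (hasDerivAt_snd_slice (z := (t, s))
          (hd _ (abs_lt.2 hs))).continuousAt.continuousWithinAt
      · rw [interior_Ioo] at hs
        rw [(hasDerivAt_snd_slice (z := (t, s)) (hd _ (abs_lt.2 hs))).deriv]
        exact (H t s (abs_lt.2 hs)).2
    exact Prod.ext rfl (hmono.injOn (abs_lt.1 hs) (abs_lt.1 hs') h2)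
  · simp
  · exact ⟨θ, by simp⟩

/-- The primitive of `w` in the first variable. -/
noncomputable def fstPrimitive (w : ℝ × ℝ → ℝ) (z : ℝ × ℝ) : ℝ :=
  ∫ τ in (0:ℝ)..z.1, w (τ, z.2)

theorem contDiff_fstPrimitive {w : ℝ × ℝ → ℝ} (hw : ContDiff ℝ (⊤ : ℕ∞) w) :
    ContDiff ℝ (⊤ : ℕ∞) (fstPrimitive w) := by
  have h : fstPrimitive w = fun z => z.1 * ∫ u in (0:ℝ)..1, w (u * z.1, z.2) := by
    ext z
    have h2 := intervalIntegral.mul_integral_comp_mul_right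
      (f := fun u => w (u, z.2)) (a := 0) (b := 1) z.1
    simp only [zero_mul, one_mul] at h2
    exact h2.symm
  rw [h]
  refine contDiff_fst.mul (contDiff_infty_intervalIntegral
    (f := fun z : (ℝ × ℝ) × ℝ => w (z.2 * z.1.1, z.1.2)) ?_)
  exact hw.comp (by fun_prop)

theorem hasDerivAt_fstPrimitive {w : ℝ × ℝ → ℝ} (hw : Continuous w) (t s : ℝ) :
    HasDerivAt (fun t => fstPrimitive w (t, s)) (w (t, s)) t :=
  ((by fun_prop : Continuous fun τ => w (τ, s)).integral_hasStrictDerivAt 0 t).hasDerivAt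

theorem fstPrimitive_add {w : ℝ × ℝ → ℝ} (hw : Continuous w) {T : ℝ}
    (hper : ∀ t s, w (t + T, s) = w (t, s)) (t s : ℝ) :
    fstPrimitive w (t + T, s) = fstPrimitive w (t, s) + fstPrimitive w (T, s) := by
  have hc : Continuous fun τ => w (τ, s) := by fun_prop
  have h1 := intervalIntegral.integral_add_adjacent_intervals
    (hc.intervalIntegrable (μ := MeasureTheory.volume) 0 t) (hc.intervalIntegrable t (t + T))
  have h2 := Function.Periodic.intervalIntegral_add_eq (f := fun τ => w (τ, s))
    (fun t => hper t s) t 0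
  rw [zero_add] at h2
  simp only [fstPrimitive]
  rw [← h1, h2]

/-- A positive periodic density is the Jacobian of a shear whose second component depends only on
the second variable. -/
theorem exists_isShear_det_eq {w : ℝ × ℝ → ℝ} (hw : ContDiff ℝ (⊤ : ℕ∞) w)
    (hper : ∀ t s, w (t + 2 * π, s) = w (t, s)) (hpos : ∀ z, 0 < w z) :
    ∃ (f : ℝ × ℝ → ℝ × ℝ) (β : ℝ → ℝ), (∀ ε > 0, IsShear ε f) ∧
      (∀ z, (fderiv ℝ f z).det = w z) ∧ (∀ z, (f z).2 = β z.2) ∧ Differentiable ℝ β ∧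
      StrictMono β := by
  set A := fstPrimitive w with hA
  have hAs : ContDiff ℝ (⊤ : ℕ∞) A := contDiff_fstPrimitive hw
  set a : ℝ → ℝ := fun s => A (2 * π, s) with ha
  have has : ContDiff ℝ (⊤ : ℕ∞) a := hAs.comp (by fun_prop)
  have hA1 : ∀ t s, HasDerivAt (fun t => A (t, s)) (w (t, s)) t :=
    fun t s => hasDerivAt_fstPrimitive hw.continuous t s
  have hA0 : ∀ s, A (0, s) = 0 := fun s => by simp [hA, fstPrimitive]
  have hAmono : ∀ s, StrictMono fun t => A (t, s) := fun s =>
    strictMono_of_deriv_pos fun t => by rw [(hA1 t s).deriv]; exact hpos _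
  have hapos : ∀ s, 0 < a s := fun s => by
    have := hAmono s two_pi_pos
    simpa [hA0] using this
  have hAadd : ∀ t s, A (t + 2 * π, s) = A (t, s) + a s :=
    fun t s => fstPrimitive_add hw.continuous hper t s
  set B : ℝ × ℝ → ℝ := fstPrimitive fun z => a z.1 / (2 * π)
  have hBs : ContDiff ℝ (⊤ : ℕ∞) B :=
    contDiff_fstPrimitive ((has.comp contDiff_fst).div_const _)
  set β : ℝ → ℝ := fun s => B (s, 0) with hβ
  have hβs : ContDiff ℝ (⊤ : ℕ∞) β := hBs.comp (by fun_prop)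
  have hβd : ∀ s, HasDerivAt β (a s / (2 * π)) s := fun s =>
    hasDerivAt_fstPrimitive (w := fun z => a z.1 / (2 * π))
      ((has.continuous.comp continuous_fst).div_const _) s 0
  have hβ0 : β 0 = 0 := by simp [hβ, B, fstPrimitive]
  have hβm : StrictMono β := strictMono_of_deriv_pos fun s => by
    rw [(hβd s).deriv]; exact div_pos (hapos s) two_pi_pos
  set α : ℝ × ℝ → ℝ := fun z => 2 * π * A z / a z.2 with hα
  have hαs : ContDiff ℝ (⊤ : ℕ∞) α :=
    (contDiff_const.mul hAs).div (has.comp contDiff_snd) fun z => (hapos _).ne'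
  have hαadd : ∀ t s, α (t + 2 * π, s) = α (t, s) + 2 * π := fun t s => by
    have := (hapos s).ne'
    simp only [hα, hAadd]
    field_simp
  have hα1 : ∀ t s, HasDerivAt (fun t => α (t, s)) (2 * π * w (t, s) / a s) t := fun t s =>
    ((hA1 t s).const_mul (2 * π)).div_const (a s)
  have hdet : ∀ z, (fderiv ℝ (fun z : ℝ × ℝ => (α z, β z.2)) z).det = w z := by
    intro z
    have h1 : DifferentiableAt ℝ (fun z : ℝ × ℝ => (α z, β z.2)) z :=
      (hαs.prodMk (hβs.comp contDiff_snd)).differentiable (by simp) z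
    have e1 := (hasDerivAt_fst_slice h1).unique ((hα1 z.1 z.2).prodMk (hasDerivAt_const z.1 (β z.2)))
    have e2 := (hasDerivAt_snd_slice h1).unique
      ((hasDerivAt_snd_slice (hαs.differentiable (by simp) z)).prodMk (hβd z.2))
    rw [det_eq_of_prod, e1, e2]
    have := (hapos z.2).ne'
    have := two_pi_pos.ne'
    simp only [Prod.mk.eta]
    field_simp
    simp
  refine ⟨fun z => (α z, β z.2), β, fun ε hε => ⟨hε, fun z _ => ?_, fun z _ => ?_, fun t s _ => ?_,
    ?_, fun t => hβ0, fun θ => ?_⟩, hdet, fun z => rfl, hβs.differentiable (by simp), hβm⟩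
  · exact (hαs.prodMk (hβs.comp contDiff_snd)).contDiffAt
  · rw [hdet]; exact hpos z
  · exact Prod.ext (hαadd t s) rfl
  · rintro ⟨t, s⟩ ⟨t', s'⟩ _ _ heq
    obtain ⟨h1, h2⟩ := Prod.mk.inj heq
    obtain rfl := hβm.injective h2
    have hm : StrictMono fun t => α (t, s) := strictMono_of_deriv_pos fun t => by
      rw [(hα1 t s).deriv]
      exact div_pos (mul_pos two_pi_pos (hpos _)) (hapos s)
    rw [hm.injective h1]
  · have hint : ∀ k : ℤ, α (k * (2 * π), 0) = k * (2 * π) := fun k => by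
      have hp : Function.Periodic (fun t => α (t, 0) - t) (2 * π) := fun t => by
        simp only [hαadd]; ring
      have := hp.int_mul k 0
      simp only [zero_add, sub_zero] at this
      rw [sub_eq_iff_eq_add] at this
      rw [this]
      simp [hα, hA0]
    set k : ℤ := ⌊θ / (2 * π)⌋
    have hk1 : k * (2 * π) ≤ θ := (le_div_iff₀ two_pi_pos).1 (Int.floor_le _)
    have hk2 : θ ≤ ((k + 1 : ℤ) : ℝ) * (2 * π) :=
      (div_le_iff₀ two_pi_pos).1 (by push_cast; exact (Int.lt_floor_add_one _).le)
    have hcont : Continuous fun t => α (t, 0) := hαs.continuous.comp (by fun_prop)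
    obtain ⟨t, _, ht⟩ := intermediate_value_Icc (a := k * (2 * π)) (b := ((k + 1 : ℤ) : ℝ) * (2 * π))
      (hk1.trans hk2) hcont.continuousOn ⟨(hint k).le.trans hk1, hk2.trans (hint (k + 1)).ge⟩
    exact ⟨t, Prod.ext ht hβ0⟩

/-- The curve `c` thickened along its normal direction. -/
noncomputable def tubeMap (c : ℝ → ℝ × ℝ) (z : ℝ × ℝ) : ℝ × ℝ :=
  c z.1 + z.2 • (-(deriv c z.1).2, (deriv c z.1).1)

theorem contDiff_tubeMap {c : ℝ → ℝ × ℝ} (hc : ContDiff ℝ (⊤ : ℕ∞) c) :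
    ContDiff ℝ (⊤ : ℕ∞) (tubeMap c) := by
  have h : ContDiff ℝ (⊤ : ℕ∞) (deriv c) := (contDiff_infty_iff_deriv.1 hc).2
  have h1 : ContDiff ℝ (⊤ : ℕ∞) fun z : ℝ × ℝ => deriv c z.1 := h.comp contDiff_fst
  exact (hc.comp contDiff_fst).add (contDiff_snd.smul (h1.snd.neg.prodMk h1.fst))

theorem tubeMap_zero (c : ℝ → ℝ × ℝ) (t : ℝ) : tubeMap c (t, 0) = c t := by
  simp [tubeMap]

theorem tubeMap_periodic {c : ℝ → ℝ × ℝ} {T : ℝ} (hper : ∀ t, c (t + T) = c t) (t s : ℝ) :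
    tubeMap c (t + T, s) = tubeMap c (t, s) := by
  have h : deriv c (t + T) = deriv c t := by
    rw [← deriv_comp_add_const]
    simp only [hper]
  simp only [tubeMap, hper, h]

theorem det_tubeMap_pos {c : ℝ → ℝ × ℝ} (hc : ContDiff ℝ (⊤ : ℕ∞) c) {t : ℝ}
    (hreg : deriv c t ≠ 0) : 0 < (fderiv ℝ (tubeMap c) (t, 0)).det := by
  have hd := (contDiff_tubeMap hc).differentiable (by simp) (t, 0)
  have e1 := hasDerivAt_fst_slice hd
  simp only [tubeMap_zero] at e1
  have e2 := (hasDerivAt_snd_slice hd).unique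
    (((hasDerivAt_id (0:ℝ)).smul_const (-(deriv c t).2, (deriv c t).1)).const_add (c t))
  have e3 : fderiv ℝ (tubeMap c) (t, 0) (1, 0) = deriv c t := e1.deriv.symm
  rw [det_eq_of_prod, e2, e3]
  have h : (deriv c t).1 ≠ 0 ∨ (deriv c t).2 ≠ 0 := by
    by_contra! h
    exact hreg (Prod.ext h.1 h.2)
  simp only [one_smul, neg_mul, sub_neg_eq_add]
  rcases h with h | h
  · exact add_pos_of_pos_of_nonneg (mul_self_pos.2 h) (mul_self_nonneg _)
  · exact add_pos_of_nonneg_of_pos (mul_self_nonneg _) (mul_self_pos.2 h)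

theorem exists_injOn_nhds_of_det_ne_zero {F : ℝ × ℝ → ℝ × ℝ} {z : ℝ × ℝ}
    (hF : ContDiffAt ℝ (⊤ : ℕ∞) F z) (hdet : (fderiv ℝ F z).det ≠ 0) :
    ∃ U ∈ 𝓝 z, InjOn F U := by
  have hd : HasStrictFDerivAt F
      ((ContinuousLinearMap.toContinuousLinearEquivOfDetNeZero _ hdet :
        (ℝ × ℝ) ≃L[ℝ] (ℝ × ℝ)) : ℝ × ℝ →L[ℝ] ℝ × ℝ) z := by
    rw [ContinuousLinearMap.coe_toContinuousLinearEquivOfDetNeZero]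
    exact hF.hasStrictFDerivAt (by simp)
  exact ⟨_, hd.eventually_left_inverse, fun x hx y hy h => by
    rw [mem_ofPred_eq] at hx hy
    rw [← hx, h, hy]⟩

/-- A map which is an immersed annulus near its core and injective on the core is injective on a
thin annulus. -/
theorem exists_injective_mod_two_pi {F : ℝ × ℝ → ℝ × ℝ} (hF : ContDiff ℝ (⊤ : ℕ∞) F)
    (hper : ∀ t s, F (t + 2 * π, s) = F (t, s)) (hdet : ∀ t, (fderiv ℝ F (t, 0)).det ≠ 0)
    (hinj : InjOn (fun t => F (t, 0)) (Ico 0 (2 * π))) :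
    ∃ ε > 0, ∀ z w : ℝ × ℝ, |z.2| < ε → |w.2| < ε → F z = F w →
      ∃ k : ℤ, z = (w.1 + k * (2 * π), w.2) := by
  have hperk := periodic_int hper
  have hmod : ∀ t s, F (toIcoMod two_pi_pos 0 t, s) = F (t, s) := fun t s => by
    rw [← hperk (toIcoDiv two_pi_pos 0 t) (toIcoMod two_pi_pos 0 t), ← zsmul_eq_mul,
      toIcoMod_add_toIcoDiv_zsmul]
  have hdecomp : ∀ t, t = toIcoMod two_pi_pos 0 t + toIcoDiv two_pi_pos 0 t * (2 * π) := fun t => by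
    rw [← zsmul_eq_mul, toIcoMod_add_toIcoDiv_zsmul]
  have hmem : ∀ t, toIcoMod two_pi_pos 0 t ∈ Ico 0 (2 * π) := fun t => by
    simpa using toIcoMod_mem_Ico two_pi_pos 0 t
  have hcore : ∀ t t', F (t, 0) = F (t', 0) → ∃ k : ℤ, t = t' + k * (2 * π) := fun t t' h => by
    have h1 : toIcoMod two_pi_pos 0 t = toIcoMod two_pi_pos 0 t' :=
      hinj (hmem t) (hmem t') (by simp only [hmod, h])
    refine ⟨toIcoDiv two_pi_pos 0 t - toIcoDiv two_pi_pos 0 t', ?_⟩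
    have h2 := hdecomp t
    have h3 := hdecomp t'
    push_cast
    rw [h1] at h2
    linarith
  have h := ((isCompact_Icc (a := (0:ℝ)) (b := 2 * π)).prod
    (isCompact_Icc (a := (0:ℝ)) (b := 2 * π))).eventually_forall_of_forall_eventually
    (x₀ := ((0:ℝ), (0:ℝ))) (P := fun s t => F (t.1, s.1) = F (t.2, s.2) →
      ∃ k : ℤ, t.1 = t.2 + k * (2 * π) ∧ s.1 = s.2) (by
    rintro ⟨t, t'⟩ -
    by_cases hne : F (t, 0) = F (t', 0)
    · obtain ⟨k, rfl⟩ := hcore t t' hne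
      obtain ⟨U, hU, hUinj⟩ := exists_injOn_nhds_of_det_ne_zero hF.contDiffAt (hdet (t' + k * (2 * π)))
      have c1 : ContinuousAt (fun z : (ℝ × ℝ) × (ℝ × ℝ) => (z.2.1, z.1.1))
        ((0, 0), (t' + k * (2 * π), t')) := by fun_prop
      have c2 : ContinuousAt (fun z : (ℝ × ℝ) × (ℝ × ℝ) => (z.2.2 + k * (2 * π), z.1.2))
        ((0, 0), (t' + k * (2 * π), t')) := by fun_prop
      filter_upwards [c1.preimage_mem_nhds hU, c2.preimage_mem_nhds hU] with z h1 h2 heq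
      have h3 := hUinj h1 h2 (by rw [heq, hperk])
      exact ⟨k, (Prod.mk.inj h3).1, (Prod.mk.inj h3).2⟩
    · have c1 : ContinuousAt (fun z : (ℝ × ℝ) × (ℝ × ℝ) => F (z.2.1, z.1.1))
        ((0, 0), (t, t')) := hF.continuous.continuousAt.comp (by fun_prop)
      have c2 : ContinuousAt (fun z : (ℝ × ℝ) × (ℝ × ℝ) => F (z.2.2, z.1.2))
        ((0, 0), (t, t')) := hF.continuous.continuousAt.comp (by fun_prop)
      filter_upwards [c1.ne_iff_eventually_ne c2 |>.1 hne] with z h1 h2 using (h1 h2).elim)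
  obtain ⟨ε, hε, H⟩ := Metric.eventually_nhds_iff.1 h
  refine ⟨ε, hε, fun ⟨t, s⟩ ⟨t', s'⟩ hs hs' heq => ?_⟩
  obtain ⟨k, hk, hss⟩ := H (y := (s, s'))
    (by rw [Prod.dist_eq]; simpa using ⟨hs, hs'⟩)
    (toIcoMod two_pi_pos 0 t, toIcoMod two_pi_pos 0 t')
    ⟨Ico_subset_Icc_self (hmem t), Ico_subset_Icc_self (hmem t')⟩ (by simp only [hmod, heq])
  refine ⟨k + toIcoDiv two_pi_pos 0 t - toIcoDiv two_pi_pos 0 t', Prod.ext ?_ hss⟩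
  have h2 := hdecomp t
  have h3 := hdecomp t'
  simp only at hk ⊢
  push_cast
  linarith

theorem continuous_det : Continuous fun L : ℝ × ℝ →L[ℝ] ℝ × ℝ => L.det := by
  simp only [det_eq_of_prod]
  fun_prop

theorem exists_isCollar_tubeMap {c : ℝ → ℝ × ℝ} (hc : ContDiff ℝ (⊤ : ℕ∞) c)
    (hper : ∀ t, c (t + 2 * π) = c t) (hreg : ∀ t, deriv c t ≠ 0)
    (hinj : InjOn c (Ico 0 (2 * π))) : ∃ ε, IsCollar (range c) ε (tubeMap c) := by
  have hs := contDiff_tubeMap hc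
  have hp := tubeMap_periodic hper
  obtain ⟨ε₁, hε₁, h1⟩ := exists_injective_mod_two_pi hs hp
    (fun t => (det_tubeMap_pos hc (hreg t)).ne') (by simpa only [tubeMap_zero] using hinj)
  obtain ⟨ε₂, hε₂, h2⟩ := exists_strip (Q := fun z => 0 < (fderiv ℝ (tubeMap c) z).det)
    (fun t => (continuous_det.comp (hs.continuous_fderiv (by simp))).continuousAt.eventually_const_lt
      (det_tubeMap_pos hc (hreg t)))
    (fun t s h k => by rwa [fderiv_add_eq_of_periodic (periodic_int hp k)])
  refine ⟨min ε₁ ε₂, lt_min hε₁ hε₂, fun z _ => hs.contDiffAt, fun z hz => ?_, fun t s _ => hp t s,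
    fun z w hz hw => ?_, fun t => ?_, ?_⟩
  · exact h2 z.1 z.2 (hz.trans_le (min_le_right _ _))
  · exact h1 z w (hz.trans_le (min_le_left _ _)) (hw.trans_le (min_le_left _ _))
  · exact ⟨t, (tubeMap_zero c t).symm⟩
  · rintro _ ⟨t, rfl⟩
    exact ⟨t, tubeMap_zero c t⟩

/-- Along a degenerate critical direction the quadratic coefficient vanishes. -/
theorem iteratedFDeriv_two_eq_zero {p : ℝ × ℝ → ℝ} (hp : ContDiff ℝ (⊤ : ℕ∞) p) {m ν : ℝ × ℝ}
    {b₀ : ℝ} {k : ℝ → ℝ} (hk : ContDiff ℝ (⊤ : ℕ∞) k)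
    (h : ∀ s : ℝ, p (m + s • ν) = b₀ + s * (s * k s)) (hk0 : k 0 = 0) :
    iteratedFDeriv ℝ 2 p m ![ν, ν] = 0 := by
  have hline : ∀ s : ℝ, HasDerivAt (fun s : ℝ => m + s • ν) ν s := fun s => by
    simpa using ((hasDerivAt_id s).smul_const ν).const_add m
  have hkd : ∀ s, HasDerivAt k (deriv k s) s := fun s =>
    (hk.differentiable (by simp) s).hasDerivAt
  have h1 : ∀ s : ℝ, fderiv ℝ p (m + s • ν) ν = s * (2 * k s + s * deriv k s) := fun s => by
    have e1 := ((hp.differentiable (by simp) (m + s • ν)).hasFDerivAt.comp_hasDerivAt s (hline s))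
    have e2 : HasDerivAt (fun s => b₀ + s * (s * k s)) (s * (2 * k s + s * deriv k s)) s :=
      (((hasDerivAt_id' s).fun_mul ((hasDerivAt_id' s).fun_mul (hkd s))).const_add b₀).congr_deriv
        (by ring)
    have e3 : (p ∘ fun s : ℝ => m + s • ν) = fun s => b₀ + s * (s * k s) := funext h
    rw [e3] at e1
    exact e1.unique e2
  have hf : ContDiff ℝ (⊤ : ℕ∞) (fderiv ℝ p) := hp.fderiv_right (by simp)
  have e1 : HasDerivAt (fun s : ℝ => fderiv ℝ p (m + s • ν) ν)
      (fderiv ℝ (fderiv ℝ p) m ν ν) 0 := by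
    have e := (hf.differentiable (by simp) m).hasFDerivAt.comp_hasDerivAt_of_eq 0 (hline 0)
      (by simp)
    simpa using e.clm_apply (hasDerivAt_const (0:ℝ) ν)
  simp only [h1] at e1
  have hk' : ContDiff ℝ (⊤ : ℕ∞) (deriv k) := (contDiff_infty_iff_deriv.1 hk).2
  have e2 : HasDerivAt (fun s => s * (2 * k s + s * deriv k s)) 0 0 :=
    ((hasDerivAt_id' (0:ℝ)).fun_mul (((hkd 0).const_mul 2).fun_add
      ((hasDerivAt_id' (0:ℝ)).fun_mul (hk'.differentiable (by simp) 0).hasDerivAt))).congr_deriv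
        (by simp [hk0])
  rw [iteratedFDeriv_two_apply]
  exact e1.unique e2

/-- Near a non-degenerate well, `p` is a square in suitable collar coordinates. -/
theorem NondegenerateWell.exists_isCollar {p : ℝ × ℝ → ℝ} {c : ℝ → ℝ × ℝ} {b₀ : ℝ}
    (hwell : NondegenerateWell p c b₀) :
    ∃ ε F, IsCollar (range c) ε F ∧ ∀ z : ℝ × ℝ, |z.2| < ε → p (F z) = b₀ + z.2 ^ 2 := by
  obtain ⟨hp, hc, hper, hreg, hinj, ⟨Ω, hΩ, hcΩ, hΩ0, hΩ1⟩, hess⟩ := hwell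
  obtain ⟨ε₀, hcol⟩ := exists_isCollar_tubeMap hc hper hreg hinj
  have hs := contDiff_tubeMap hc
  set q : ℝ × ℝ → ℝ := p ∘ tubeMap c with hq
  have hqs : ContDiff ℝ (⊤ : ℕ∞) q := hp.comp hs
  have hqper : ∀ t s, q (t + 2 * π, s) = q (t, s) := fun t s => by
    simp only [hq, Function.comp, tubeMap_periodic hper]
  have hq0 : ∀ t, q (t, 0) = b₀ := fun t => by
    simp only [hq, Function.comp, tubeMap_zero]
    exact hΩ0 _ ⟨t, rfl⟩
  have hmin : ∀ t, ∀ᶠ s in 𝓝 (0:ℝ), b₀ ≤ q (t, s) := fun t => by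
    have hcont : ContinuousAt (fun s => tubeMap c (t, s)) 0 :=
      (hs.continuous.comp (by fun_prop)).continuousAt
    filter_upwards [hcont.preimage_mem_nhds (hΩ.mem_nhds (by
      rw [tubeMap_zero]; exact hcΩ ⟨t, rfl⟩))] with s hs
    by_cases hm : tubeMap c (t, s) ∈ range c
    · exact (hΩ0 _ hm).ge
    · exact (hΩ1 _ ⟨hs, hm⟩).le
  set h := hadamardQuotient (hadamardQuotient q) with hh
  have hhs : ContDiff ℝ (⊤ : ℕ∞) h := contDiff_hadamardQuotient (contDiff_hadamardQuotient hqs)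
  have hhper : ∀ t s, h (t + 2 * π, s) = h (t, s) :=
    hadamardQuotient_periodic (hadamardQuotient_periodic hqper)
  have hqh : ∀ t s, q (t, s) = b₀ + s * (s * h (t, s)) := fun t s => by
    have h1 : hadamardQuotient q (t, 0) = 0 := by
      rw [hadamardQuotient_zero]
      have e1 := hasDerivAt_snd_slice (z := (t, 0)) (hqs.differentiable (by simp) _)
      have e2 : IsLocalMin (fun s => q (t, s)) 0 := by
        filter_upwards [hmin t] with s hs
        rwa [hq0]
      exact e2.hasDerivAt_eq_zero e1
    rw [eq_add_mul_hadamardQuotient hqs, hq0,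
      eq_add_mul_hadamardQuotient (contDiff_hadamardQuotient hqs) t s, h1, zero_add]
  have hhline : ∀ t, ContDiff ℝ (⊤ : ℕ∞) fun s => h (t, s) := fun t => hhs.comp (by fun_prop)
  have hpos : ∀ t, 0 < h (t, 0) := fun t => by
    refine lt_of_le_of_ne ?_ fun h0 => ?_
    · have htend : Tendsto (fun s => h (t, s)) (𝓝[≠] 0) (𝓝 (h (t, 0))) :=
        (hhline t).continuous.continuousAt.tendsto.mono_left nhdsWithin_le_nhds
      refine ge_of_tendsto htend ?_
      filter_upwards [nhdsWithin_le_nhds (hmin t), self_mem_nhdsWithin] with s hs hs0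
      rw [hqh] at hs
      have : 0 < s * s := mul_self_pos.2 hs0
      by_contra! hneg
      nlinarith
    · refine hess t (-(deriv c t).2, (deriv c t).1) (fun hν => hreg t ?_) (by ring)
        (iteratedFDeriv_two_eq_zero hp (hhline t) (fun s => hqh t s) h0.symm)
      have h1 := congrArg Prod.fst hν
      have h2 := congrArg Prod.snd hν
      exact Prod.ext (by simpa using h2) (by simpa using h1)
  obtain ⟨ε₁, hf, hε₁⟩ := exists_isShear_mul_sqrt hhs hhper hpos
  have hε := lt_min hcol.pos hf.pos
  have hf' := hf.mono hε (min_le_right _ _)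
  obtain ⟨δ, e, he⟩ := hf'.exists_inverse
  refine ⟨δ, tubeMap c ∘ e, he.collar_comp hf' (hcol.mono hε (min_le_left _ _)), fun z hz => ?_⟩
  have h1 := hqh (e z).1 (e z).2
  have h2 := congrArg Prod.snd (he.right_inv z hz)
  have h3 := hε₁ (e z) ((he.mem z hz).trans_le (min_le_right _ _))
  simp only at h2
  rw [← h2, mul_pow, Real.sq_sqrt h3.le]
  simp only [Prod.mk.eta] at h1
  rw [Function.comp]
  exact h1.trans (by ring)

/-- The Jacobian of a collar is, on a smaller annulus, the restriction of a positive smooth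
periodic function defined on the whole plane. -/
theorem IsCollar.exists_density {γ : Set (ℝ × ℝ)} {ε : ℝ} {F : ℝ × ℝ → ℝ × ℝ}
    (hF : IsCollar γ ε F) : ∃ w : ℝ × ℝ → ℝ, ContDiff ℝ (⊤ : ℕ∞) w ∧
      (∀ t s, w (t + 2 * π, s) = w (t, s)) ∧ (∀ z, 0 < w z) ∧
      ∃ ε' > 0, ε' ≤ ε ∧ ∀ z : ℝ × ℝ, |z.2| < ε' → (fderiv ℝ F z).det = w z := by
  have hε := hF.pos
  let χ : ContDiffBump (0:ℝ) := ⟨ε / 3, ε / 2, by linarith, by linarith⟩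
  set κ : ℝ → ℝ := fun s => s * χ s with hκ
  have hκs : ContDiff ℝ (⊤ : ℕ∞) κ := contDiff_id.mul χ.contDiff
  have hκlt : ∀ s, |κ s| < ε := fun s => by
    by_cases hs : |s| < ε / 2
    · rw [hκ, abs_mul, abs_of_nonneg χ.nonneg]
      have := χ.le_one (x := s)
      nlinarith [abs_nonneg s]
    · have : χ s = 0 := χ.zero_of_le_dist (by simpa [χ] using not_lt.1 hs)
      simpa [hκ, this] using hε
  have hκeq : ∀ s, |s| < ε / 3 → κ s = s := fun s hs => by
    have : χ s = 1 := χ.one_of_mem_closedBall (by simpa [χ] using hs.le)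
    simp [hκ, this]
  have hd : ∀ z : ℝ × ℝ, |z.2| < ε → ContDiffAt ℝ (⊤ : ℕ∞) (fun z => (fderiv ℝ F z).det) z :=
    fun z hz => by
    have h : ContDiffAt ℝ (⊤ : ℕ∞) (fderiv ℝ F) z := (hF.contDiffAt z hz).fderiv_right (by simp)
    have hv : ∀ v, ContDiffAt ℝ (⊤ : ℕ∞) (fun z => fderiv ℝ F z v) z :=
      fun v => h.clm_apply contDiffAt_const
    simp only [det_eq_of_prod]
    exact ((hv _).fst.mul (hv _).snd).sub ((hv _).fst.mul (hv _).snd)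
  refine ⟨fun z => (fderiv ℝ F (z.1, κ z.2)).det, ?_, fun t s => ?_, fun z => ?_, ε / 3,
    by linarith, by linarith, fun z hz => ?_⟩
  · rw [contDiff_iff_contDiffAt]
    intro z
    exact ContDiffAt.comp (g := fun z => (fderiv ℝ F z).det) (f := fun z => (z.1, κ z.2)) z
      (hd (z.1, κ z.2) (hκlt _))
      (contDiff_fst.prodMk (hκs.comp contDiff_snd)).contDiffAt
  · have h1 : (fun z => F (z + (2 * π, 0))) =ᶠ[𝓝 (t, κ s)] F := by
      filter_upwards [(isOpen_strip ε).mem_nhds (x := (t, κ s)) (hκlt s)] with z hz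
      rw [show z + (2 * π, 0) = (z.1 + 2 * π, z.2) from Prod.ext rfl (add_zero _)]
      exact hF.periodic z.1 z.2 hz
    have h2 := fderiv_comp_add_right (𝕜 := ℝ) (f := F) (x := (t, κ s)) (2 * π, 0)
    rw [h1.fderiv_eq] at h2
    simp only [Prod.mk_add_mk, add_zero] at h2
    simp only [h2]
  · exact hF.det_pos _ (hκlt _)
  · simp only [hκeq _ hz]

/-- Folded action-angle coordinates: there are symplectic coordinates `(θ, I)` near the well
in which `p = b₀ + g(I)²` with `g(0) = 0` and `g' ≠ 0`. -/
theorem folded_action_angle_normal_form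
    (p : ℝ × ℝ → ℝ) (c : ℝ → ℝ × ℝ) (b₀ : ℝ)
    (hwell : NondegenerateWell p c b₀) :
    ∃ (δ : ℝ) (g : ℝ → ℝ) (Φ : ℝ × ℝ → ℝ × ℝ),
      0 < δ ∧
      ContDiffOn ℝ (⊤ : ℕ∞) g (Set.Ioo (-δ) δ) ∧ g 0 = 0 ∧
      (∀ I ∈ Set.Ioo (-δ) δ, deriv g I ≠ 0) ∧
      ContDiffOn ℝ (⊤ : ℕ∞) Φ (Set.univ ×ˢ Set.Ioo (-δ) δ) ∧
      (∀ θ : ℝ, ∀ I ∈ Set.Ioo (-δ) δ, Φ (θ + 2 * π, I) = Φ (θ, I)) ∧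
      Set.InjOn Φ (Set.Ico 0 (2 * π) ×ˢ Set.Ioo (-δ) δ) ∧
      (∀ z ∈ Set.univ ×ˢ Set.Ioo (-δ) δ, (fderiv ℝ Φ z).det = 1) ∧
      IsOpen (Φ '' (Set.univ ×ˢ Set.Ioo (-δ) δ)) ∧
      Set.range c ⊆ Φ '' (Set.univ ×ˢ Set.Ioo (-δ) δ) ∧
      (∀ θ : ℝ, Φ (θ, 0) ∈ Set.range c) ∧
      (∀ θ : ℝ, ∀ I ∈ Set.Ioo (-δ) δ, p (Φ (θ, I)) = b₀ + (g I) ^ 2) := by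
  obtain ⟨ε₀, F, hF₀, hpF⟩ := hwell.exists_isCollar
  obtain ⟨w, hw, hwper, hwpos, ε, hε, hεε₀, hdet⟩ := hF₀.exists_density
  have hF := hF₀.mono hε hεε₀
  obtain ⟨f, β, hfε, hfdet, hfβ, hβd, hβm⟩ := exists_isShear_det_eq hw hwper hwpos
  have hf := hfε ε hε
  obtain ⟨δ, e, he⟩ := hf.exists_inverse
  have hΦ := he.collar_comp hf hF
  have hδ := he.pos
  have hβe : ∀ z : ℝ × ℝ, |z.2| < δ → β (e z).2 = z.2 := fun z hz => by
    rw [← hfβ, he.right_inv z hz]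
  have he2 : ∀ θ I, |I| < δ → (e (θ, I)).2 = (e (0, I)).2 := fun θ I hI =>
    hβm.injective ((hβe (θ, I) hI).trans (hβe (0, I) hI).symm)
  have hes : ∀ I, |I| < δ → ContDiffAt ℝ (⊤ : ℕ∞) (fun I => (e (0, I)).2) I := fun I hI =>
    ((he.contDiffAt (0, I) hI).comp I
      (contDiffAt_const.prodMk contDiffAt_id : ContDiffAt ℝ _ (fun I : ℝ => ((0:ℝ), I)) I)).snd
  have hdet1 : ∀ z : ℝ × ℝ, |z.2| < δ → (fderiv ℝ (F ∘ e) z).det = 1 := fun z hz => by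
    rw [he.det_comp hF hz, hdet _ (he.mem z hz), ← hfdet, he.det_mul_det hf hz]
  have hU : IsOpen ((univ : Set ℝ) ×ˢ Ioo (-δ) δ) := isOpen_univ.prod isOpen_Ioo
  refine ⟨δ, fun I => (e (0, I)).2, F ∘ e, hδ, fun I hI => ?_, he.snd_core hf 0, fun I hI => ?_,
    fun z hz => ?_, fun θ I hI => ?_, ?_, fun z hz => ?_, ?_, ?_, hΦ.core_mem, fun θ I hI => ?_⟩
  · exact (hes I (abs_lt.2 hI)).contDiffWithinAt
  · intro h0
    have h1 := ((hes I (abs_lt.2 hI)).differentiableAt (by simp)).hasDerivAt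
    have h2 := (hβd (e (0, I)).2).hasDerivAt.comp I h1
    have h3 : (β ∘ fun I => (e (0, I)).2) =ᶠ[𝓝 I] id := by
      filter_upwards [isOpen_Ioo.mem_nhds hI] with J hJ using hβe (0, J) (abs_lt.2 hJ)
    have h4 := (h2.congr_of_eventuallyEq h3.symm).unique (hasDerivAt_id I)
    simp [h0] at h4
  · exact (hΦ.contDiffAt z (abs_lt.2 hz.2)).contDiffWithinAt
  · exact hΦ.periodic θ I (abs_lt.2 hI)
  · rintro ⟨θ, I⟩ ⟨h1, h2⟩ ⟨θ', I'⟩ ⟨h1', h2'⟩ heq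
    obtain ⟨k, hk⟩ := hΦ.inj _ _ (abs_lt.2 h2) (abs_lt.2 h2') heq
    obtain ⟨hk1, hk2⟩ := Prod.mk.inj hk
    simp only [mem_Ico] at h1 h1' hk1 hk2
    have hk0 : k = 0 := by
      have hlt : (k:ℝ) < 1 := by nlinarith [two_pi_pos]
      have hgt : (-1:ℝ) < k := by nlinarith [two_pi_pos]
      have : k < 1 := by exact_mod_cast hlt
      have : -1 < k := by exact_mod_cast hgt
      omega
    rw [hk1, hk2, hk0]
    simp
  · exact hdet1 z (abs_lt.2 hz.2)
  · rw [isOpen_iff_mem_nhds]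
    rintro _ ⟨z, hz, rfl⟩
    have hz' : |z.2| < δ := abs_lt.2 hz.2
    have hd : (fderiv ℝ (F ∘ e) z).det ≠ 0 := by rw [hdet1 z hz']; exact one_ne_zero
    obtain ⟨V, hV, hVinj⟩ := exists_injOn_nhds_of_det_ne_zero (hΦ.contDiffAt z hz') hd
    obtain ⟨W, hWV, hW, hzW⟩ := mem_nhds_iff.1 (Filter.inter_mem hV (hU.mem_nhds hz))
    refine mem_of_superset (contDiffAt_invFunOn hW (hVinj.mono fun x hx => (hWV hx).1) hzW
      (hΦ.contDiffAt z hz') hd).1 (image_mono fun x hx => (hWV hx).2)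
  · intro m hm
    obtain ⟨t, ht⟩ := hΦ.core_surj m hm
    exact ⟨(t, 0), ⟨mem_univ _, by simpa using hδ⟩, ht⟩
  · have hI' : |I| < δ := abs_lt.2 hI
    rw [Function.comp, hpF _ ((he.mem (θ, I) hI').trans_le hεε₀), he2 θ I hI']
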